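/- Suppose Jacod's density hypothesis holds. Then there exists a density family for L, i.e., a jointly measurable function q : E × Ω × [0,∞) → [0,∞), written (x,ω,t) ↦ q^x_t(ω), such that: (i) for every x ∈ E, the path t ↦ q^x_t(ω) is right-continuous for every ω, and the process (q^x_t)_{t≥0} is F-adapted and a martingale on (Ω, F, P); (ii) for every t ≥ 0, for P-a.e. ω, ν_t(ω, B) = ∫_B q^x_t(ω) λ(dx) for all B ∈ B_E. -/

import Mathlib

open MeasureTheory Set
open scoped ENNReal NNReal

section DensityFamily

open ProbabilityTheory Filter Topology

theorem Measurable.prod_section {E Ω β : Type*} {_ : MeasurableSpace E} {_ : MeasurableSpace Ω}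
    {_ : MeasurableSpace β} {f : E × Ω → β} (hf : Measurable f) (x : E) :
    Measurable fun ω => f (x, ω) :=
  hf.comp measurable_prodMk_left

theorem Measurable.prod_mono_right {E Ω β : Type*} {mE : MeasurableSpace E}
    {m m' : MeasurableSpace Ω} {_ : MeasurableSpace β} {f : E × Ω → β} (h : m ≤ m')
    (hf : Measurable[mE.prod m] f) : Measurable[mE.prod m'] f :=
  hf.mono (sup_le_sup le_rfl (MeasurableSpace.comap_mono h)) le_rfl

section JointConditioning

variable {E Ω Ω' : Type*} {mE : MeasurableSpace E} {mΩ : MeasurableSpace Ω}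
  {mΩ' : MeasurableSpace Ω'}
  {P : Measure Ω} {P' : Measure Ω'} {π : Ω → Ω'}

/-- A measurable family of nonnegative random variables, conditioned on a factor `π`, has a jointly
measurable version: case of indicators. -/
theorem exists_measurable_forall_setLIntegral_eq_indicator [IsFiniteMeasure P]
    (hπ : MeasurePreserving π P P') {C : Set (E × Ω)} (hC : MeasurableSet C) :
    ∃ g : E × Ω' → ℝ≥0∞, Measurable g ∧ ∀ x : E, ∀ A : Set Ω', MeasurableSet A →
      ∫⁻ ω in A, g (x, ω) ∂P' = ∫⁻ ω in π ⁻¹' A, C.indicator 1 (x, ω) ∂P := by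
  have : IsFiniteMeasure P' := hπ.map_eq ▸ inferInstance
  induction C, hC using MeasurableSpace.induction_on_inter generateFrom_prod.symm
    isPiSystem_prod with
  | empty => exact ⟨0, measurable_zero, by simp⟩
  | basic C hC =>
    obtain ⟨B, hB, D, hD, rfl⟩ := hC
    have hac : (P.restrict D).map π ≪ P' := by
      rw [← hπ.map_eq]
      exact Measure.AbsolutelyContinuous.map Measure.restrict_le_self.absolutelyContinuous
        hπ.measurable
    refine ⟨fun p => B.indicator 1 p.1 * ((P.restrict D).map π).rnDeriv P' p.2,
      ((measurable_one.indicator hB).comp measurable_fst).mul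
        ((Measure.measurable_rnDeriv _ _).comp measurable_snd), fun x A hA => ?_⟩
    by_cases hx : x ∈ B
    · have h1 : ∀ ω, (B ×ˢ D).indicator (1 : E × Ω → ℝ≥0∞) (x, ω) = D.indicator 1 ω := by
        intro ω; by_cases hω : ω ∈ D <;> simp [hx, hω]
      simp only [h1, hx, indicator_of_mem, Pi.one_apply, one_mul]
      rw [Measure.setLIntegral_rnDeriv hac, Measure.map_apply hπ.measurable hA,
        lintegral_indicator_one hD, Measure.restrict_apply (hπ.measurable hA),
        Measure.restrict_apply hD, inter_comm]
    · simp [indicator, hx]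
  | compl C hC ih =>
    obtain ⟨g, hg, h⟩ := ih
    have hg' (x : E) : Measurable fun ω => g (x, ω) := hg.comp measurable_prodMk_left
    have hle (x : E) : (fun ω => g (x, ω)) ≤ᵐ[P'] fun _ => 1 := by
      refine ae_le_of_forall_setLIntegral_le_of_sigmaFinite (hg' x) fun A hA _ => ?_
      rw [h x A hA, ← hπ.setLIntegral_comp_preimage hA measurable_const]
      exact lintegral_mono fun ω => indicator_le_self' (by simp) _
    refine ⟨fun p => 1 - g p, measurable_const.sub hg, fun x A hA => ?_⟩
    have hC1 : ∀ ω, Cᶜ.indicator (1 : E × Ω → ℝ≥0∞) (x, ω) = 1 - C.indicator 1 (x, ω) := by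
      intro ω; by_cases hm : (x, ω) ∈ C <;> simp [hm]
    have hm : Measurable fun ω => C.indicator (1 : E × Ω → ℝ≥0∞) (x, ω) :=
      (measurable_one.indicator hC).comp measurable_prodMk_left
    have hfin : ∫⁻ ω in π ⁻¹' A, C.indicator 1 (x, ω) ∂P ≠ ∞ := by
      refine ne_top_of_le_ne_top (measure_ne_top P (π ⁻¹' A)) ?_
      rw [← setLIntegral_one]
      exact lintegral_mono fun ω => indicator_le_self' (by simp) _
    simp only [hC1]
    rw [lintegral_sub (hg' x) (by rwa [h x A hA]) (ae_restrict_of_ae (hle x)),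
      lintegral_sub (f := fun _ => 1) hm hfin
        (Eventually.of_forall fun ω => indicator_le_self' (by simp) _), h x A hA,
        setLIntegral_one, setLIntegral_one, hπ.measure_preimage hA.nullMeasurableSet]
  | iUnion C hd hC ih =>
    choose g hg h using ih
    have hg' (i : ℕ) (x : E) : Measurable fun ω => g i (x, ω) :=
      (hg i).comp measurable_prodMk_left
    have hm (i : ℕ) (x : E) : Measurable fun ω => (C i).indicator (1 : E × Ω → ℝ≥0∞) (x, ω) :=
      (measurable_one.indicator (hC i)).comp measurable_prodMk_left
    refine ⟨fun p => ∑' i, g i p, Measurable.tsum hg, fun x A hA => ?_⟩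
    have h1 : ∀ p, (⋃ i, C i).indicator (1 : E × Ω → ℝ≥0∞) p = ∑' i, (C i).indicator 1 p := by
      intro p
      by_cases hp : ∃ i, p ∈ C i
      · obtain ⟨i, hi⟩ := hp
        rw [tsum_eq_single i fun j hj => indicator_of_notMem
          (fun hpj => (hd hj).le_bot ⟨hpj, hi⟩) _, indicator_of_mem hi,
          indicator_of_mem (mem_iUnion_of_mem i hi)]
      · push Not at hp
        simp [hp]
    simp only [h1]
    rw [lintegral_tsum fun i => (hg' i x).aemeasurable,
      lintegral_tsum fun i =>
        (hm i x).aemeasurable]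
    simp only [h _ x A hA]

theorem exists_measurable_forall_setLIntegral_eq [IsFiniteMeasure P]
    (hπ : MeasurePreserving π P P') {f : E × Ω → ℝ≥0∞} (hf : Measurable f) :
    ∃ g : E × Ω' → ℝ≥0∞, Measurable g ∧ ∀ x : E, ∀ A : Set Ω', MeasurableSet A →
      ∫⁻ ω in A, g (x, ω) ∂P' = ∫⁻ ω in π ⁻¹' A, f (x, ω) ∂P := by
  have : IsFiniteMeasure P' := hπ.map_eq ▸ inferInstance
  refine Measurable.ennreal_induction (motive := fun f => ∃ g : E × Ω' → ℝ≥0∞, Measurable g ∧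
    ∀ x : E, ∀ A : Set Ω', MeasurableSet A →
      ∫⁻ ω in A, g (x, ω) ∂P' = ∫⁻ ω in π ⁻¹' A, f (x, ω) ∂P) ?_ ?_ ?_ hf
  · intro c C hC
    obtain ⟨g, hg, h⟩ := exists_measurable_forall_setLIntegral_eq_indicator hπ hC
    refine ⟨fun p => c * g p, hg.const_mul c, fun x A hA => ?_⟩
    have h1 : ∀ p, C.indicator (fun _ : E × Ω => c) p = c * C.indicator 1 p := by
      intro p; by_cases hp : p ∈ C <;> simp [hp]
    simp only [h1]
    rw [lintegral_const_mul _ (hg.prod_section x), lintegral_const_mul _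
      ((measurable_one.indicator hC).prod_section x), h x A hA]
  · intro f₁ f₂ _ hf₁ hf₂ ih₁ ih₂
    obtain ⟨g₁, hg₁, h₁⟩ := ih₁
    obtain ⟨g₂, hg₂, h₂⟩ := ih₂
    refine ⟨fun p => g₁ p + g₂ p, hg₁.add hg₂, fun x A hA => ?_⟩
    simp only [Pi.add_apply]
    rw [lintegral_add_left (hg₁.prod_section x), lintegral_add_left (hf₁.prod_section x),
      h₁ x A hA, h₂ x A hA]
  · intro f hf hmono ih
    choose g hg h using ih
    have hg' (n : ℕ) (x : E) : Measurable fun ω => g n (x, ω) :=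
      (hg n).comp measurable_prodMk_left
    refine ⟨fun p => ⨆ n, g n p, Measurable.iSup hg, fun x A hA => ?_⟩
    dsimp only
    rw [lintegral_iSup (fun n => (hf n).prod_section x) fun i j hij ω => hmono hij _,
      lintegral_iSup_ae (fun n => hg' n x) fun n => ?_]
    · simp only [h _ x A hA]
    · refine ae_restrict_of_ae (ae_le_of_forall_setLIntegral_le_of_sigmaFinite (hg' n x)
        fun A hA _ => ?_)
      rw [h n x A hA, h n.succ x A hA]
      exact lintegral_mono fun ω => hmono n.le_succ _

/-- If two jointly measurable families have the same integrals over all rectangles, then for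
almost every parameter one is the conditional expectation of the other given the factor `π`. -/
theorem ae_forall_setLIntegral_eq_of_setLIntegral_prod_eq [IsFiniteMeasure P]
    (hπ : MeasurePreserving π P P') (μ : Measure E) [IsFiniteMeasure μ]
    {f : E × Ω → ℝ≥0∞} (hf : Measurable f) {g : E × Ω' → ℝ≥0∞} (hg : Measurable g)
    (hfin : ∫⁻ x, ∫⁻ ω, f (x, ω) ∂P ∂μ ≠ ∞)
    (h : ∀ B : Set E, MeasurableSet B → ∀ A : Set Ω', MeasurableSet A →
      ∫⁻ x in B, ∫⁻ ω in A, g (x, ω) ∂P' ∂μ = ∫⁻ x in B, ∫⁻ ω in π ⁻¹' A, f (x, ω) ∂P ∂μ) :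
    ∀ᵐ x ∂μ, ∀ A : Set Ω', MeasurableSet A →
      ∫⁻ ω in A, g (x, ω) ∂P' = ∫⁻ ω in π ⁻¹' A, f (x, ω) ∂P := by
  have : IsFiniteMeasure P' := hπ.map_eq ▸ inferInstance
  obtain ⟨k, hk, hkf⟩ := exists_measurable_forall_setLIntegral_eq hπ hf
  have key : g =ᵐ[μ.prod P'] k := by
    refine ae_eq_of_setLIntegral_prod_eq hg.aemeasurable hk.aemeasurable ?_ fun B hB A hA => ?_
    · rw [lintegral_prod _ hg.aemeasurable]
      have := h univ .univ univ .univ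
      simp only [Measure.restrict_univ, preimage_univ] at this
      rwa [this]
    · rw [← Measure.prod_restrict, lintegral_prod _ hg.aemeasurable,
        lintegral_prod _ hk.aemeasurable, h B hB A hA]
      simp only [hkf _ A hA]
  filter_upwards [Measure.ae_ae_of_ae_prod key] with x hx A hA
  rw [← hkf x A hA]
  exact lintegral_congr_ae (ae_restrict_of_ae hx)

end JointConditioning

/-- A finite kernel with countably generated target has, with respect to a fixed finite measure, a
jointly measurable density at every point where it is absolutely continuous. -/
theorem exists_measurable_withDensity_eq {E Ω : Type*} {mE : MeasurableSpace E}
    [MeasurableSpace.CountablyGenerated E] {mΩ : MeasurableSpace Ω} (μ : Measure E) [IsFiniteMeasure μ]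
    (ν : Ω → Measure E) (hν_prob : ∀ ω, IsProbabilityMeasure (ν ω))
    (hν_meas : ∀ B : Set E, MeasurableSet B → Measurable fun ω => ν ω B) :
    ∃ f : E × Ω → ℝ≥0∞, Measurable f ∧
      ∀ ω, ν ω ≪ μ → ∀ B : Set E, MeasurableSet B → ∫⁻ x in B, f (x, ω) ∂μ = ν ω B := by
  let κ : Kernel Ω E := ⟨ν, Measure.measurable_of_measurable_coe _ hν_meas⟩
  have : IsMarkovKernel κ := ⟨hν_prob⟩
  refine ⟨fun p => κ.rnDeriv (Kernel.const Ω μ) p.2 p.1,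
    (Kernel.measurable_rnDeriv _ _).comp measurable_swap, fun ω hω B _ => ?_⟩
  have hac : κ ω ≪ Kernel.const Ω μ ω := by simpa [κ] using hω
  simpa [κ] using Kernel.setLIntegral_rnDeriv (s := B) hac ‹_›

/-- The nonnegative dyadic rationals. -/
def dyadicTimes : Set ℝ≥0 := range fun p : ℕ × ℕ => (p.1 : ℝ≥0) / 2 ^ p.2

theorem countable_dyadicTimes : dyadicTimes.Countable := countable_range _

theorem div_two_pow_mem_dyadicTimes (k n : ℕ) : (k : ℝ≥0) / 2 ^ n ∈ dyadicTimes := ⟨(k, n), rfl⟩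

theorem min_mem_dyadicTimes {s t : ℝ≥0} (hs : s ∈ dyadicTimes) (ht : t ∈ dyadicTimes) :
    min s t ∈ dyadicTimes := by
  rcases min_choice s t with h | h <;> rwa [h]

theorem eventually_floor_mul_two_pow_div {r : ℝ≥0} (hr : r ∈ dyadicTimes) :
    ∀ᶠ n : ℕ in atTop, (⌊r * 2 ^ n⌋₊ : ℝ≥0) / 2 ^ n = r := by
  obtain ⟨⟨k, m⟩, rfl⟩ := hr
  filter_upwards [eventually_ge_atTop m] with n hn
  obtain ⟨j, rfl⟩ := Nat.exists_eq_add_of_le hn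
  have h : (k : ℝ≥0) / 2 ^ m * 2 ^ (m + j) = (k * 2 ^ j : ℕ) := by
    push_cast
    field_simp
    ring
  rw [h, Nat.floor_natCast, ← h]
  field_simp

/-- Dyadic times strictly decreasing to `t` from the right. -/
noncomputable def dyadicAbove (t : ℝ≥0) (n : ℕ) : ℝ≥0 := ((⌊t * 2 ^ n⌋₊ + 1 : ℕ) : ℝ≥0) / 2 ^ n

theorem dyadicAbove_mem (t : ℝ≥0) (n : ℕ) : dyadicAbove t n ∈ dyadicTimes :=
  div_two_pow_mem_dyadicTimes _ _

theorem lt_dyadicAbove (t : ℝ≥0) (n : ℕ) : t < dyadicAbove t n := by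
  rw [dyadicAbove, lt_div_iff₀ (by positivity)]
  exact_mod_cast Nat.lt_floor_add_one _

theorem dyadicAbove_le (t : ℝ≥0) (n : ℕ) : dyadicAbove t n ≤ t + (1 / 2) ^ n := by
  rw [dyadicAbove, div_le_iff₀ (by positivity), add_mul, ← mul_pow]
  push_cast
  simpa using Nat.floor_le (zero_le (a := t * 2 ^ n))

theorem tendsto_dyadicAbove (t : ℝ≥0) :
    Tendsto (dyadicAbove t) atTop (𝓝[dyadicTimes ∩ Ioi t] t) := by
  refine tendsto_nhdsWithin_iff.2
    ⟨?_, Eventually.of_forall fun n => ⟨dyadicAbove_mem t n, lt_dyadicAbove t n⟩⟩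
  refine tendsto_of_tendsto_of_tendsto_of_le_of_le tendsto_const_nhds ?_
    (fun n => (lt_dyadicAbove t n).le) (dyadicAbove_le t)
  have h : Tendsto (fun n : ℕ => ((1 : ℝ≥0) / 2) ^ n) atTop (𝓝 0) :=
    NNReal.tendsto_pow_atTop_nhds_zero_of_lt_one (by simp [one_div, inv_lt_one_iff₀])
  simpa using tendsto_const_nhds.add h

theorem eventually_dyadicAbove_lt {t u : ℝ≥0} (h : t < u) :
    ∀ᶠ n in atTop, dyadicAbove t n < u :=
  (tendsto_nhds_of_tendsto_nhdsWithin (tendsto_dyadicAbove t)).eventually_lt_const h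

theorem exists_dyadicTimes_between {t u : ℝ≥0} (h : t < u) : ∃ T ∈ dyadicTimes, t < T ∧ T < u := by
  obtain ⟨n, hn⟩ := (eventually_dyadicAbove_lt h).exists
  exact ⟨_, dyadicAbove_mem t n, lt_dyadicAbove t n, hn⟩

theorem measurable_floor_mul_two_pow (n : ℕ) : Measurable fun t : ℝ≥0 => ⌊t * 2 ^ n⌋₊ :=
  Nat.measurable_floor.comp (measurable_id.mul_const _)

section Regularization

variable {Ω Ω' : Type*}

/-- The process `X` stopped at `T` and sampled along the grid of mesh `2⁻ⁿ`. -/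
noncomputable def gridProcess (X : ℝ≥0 → Ω → ℝ) (T : ℝ≥0) (n : ℕ) : ℕ → Ω → ℝ :=
  fun k => X (min ((k : ℝ≥0) / 2 ^ n) T)

/-- Along dyadic times up to `T`, the path of `X` is bounded and its numbers of upcrossings do not
blow up under grid refinement. -/
def IsRegularUpTo (X : ℝ≥0 → Ω → ℝ) (T : ℝ≥0) (ω : Ω) : Prop :=
  (∃ K : ℕ, ∀ d ∈ dyadicTimes, d ≤ T → X d ω ≤ K) ∧
    ∀ a b : ℚ, a < b →
      liminf (fun n => (upcrossingsBefore (a : ℝ) b (gridProcess X T n) ⌊T * 2 ^ n⌋₊ ω : ℝ≥0∞))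
        atTop < ∞

theorem upperCrossingTime_comp (f : ℕ → Ω' → ℝ) (φ : Ω → Ω') (a b : ℝ) (N n : ℕ) (ω : Ω) :
    upperCrossingTime a b (fun k ω => f k (φ ω)) N n ω = upperCrossingTime a b f N n (φ ω) := by
  induction n with
  | zero => rfl
  | succ n ih =>
    rw [upperCrossingTime_succ, upperCrossingTime_succ, ih]
    rfl

theorem isRegularUpTo_comp (X : ℝ≥0 → Ω' → ℝ) (φ : Ω → Ω') (T : ℝ≥0) (ω : Ω) :
    IsRegularUpTo (fun t ω => X t (φ ω)) T ω ↔ IsRegularUpTo X T (φ ω) := by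
  have h (a b : ℝ) (n N : ℕ) :
      upcrossingsBefore a b (gridProcess (fun t ω => X t (φ ω)) T n) N ω =
        upcrossingsBefore a b (gridProcess X T n) N (φ ω) := by
    simp only [upcrossingsBefore]
    congr! 3 with k
    exact iff_of_eq (congrArg (· < N) (upperCrossingTime_comp (gridProcess X T n) φ a b N k ω))
  simp only [IsRegularUpTo, h]

theorem eventually_le_upcrossingsBefore {X : ℝ≥0 → Ω → ℝ} {t T : ℝ≥0} {ω : Ω} {a b : ℝ}
    (hab : a < b)
    (ha : ∀ r, t < r → ∃ s ∈ dyadicTimes, t < s ∧ s < r ∧ X s ω < a)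
    (hb : ∀ r, t < r → ∃ s ∈ dyadicTimes, t < s ∧ s < r ∧ b < X s ω) (k : ℕ) :
    ∀ r ∈ dyadicTimes, t < r → r ≤ T →
      ∀ᶠ n in atTop, k ≤ upcrossingsBefore a b (gridProcess X T n) ⌊r * 2 ^ n⌋₊ ω := by
  induction k with
  | zero => intros; simp
  | succ k ih =>
    intro r hr htr hrT
    obtain ⟨v, hv, htv, hvr, hXv⟩ := hb r htr
    obtain ⟨u, hu, htu, huv, hXu⟩ := ha v htv
    have hvT := hvr.le.trans hrT
    have huT := huv.le.trans hvT
    filter_upwards [ih u hu htu huT, eventually_floor_mul_two_pow_div hr,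
      eventually_floor_mul_two_pow_div hu, eventually_floor_mul_two_pow_div hv]
      with n hk hnr hnu hnv
    have h2 : (0 : ℝ≥0) < 2 ^ n := by positivity
    have hlt : ⌊v * 2 ^ n⌋₊ < ⌊r * 2 ^ n⌋₊ := by
      have := hvr
      rw [← hnr, ← hnv, div_lt_div_iff_of_pos_right h2] at this
      exact_mod_cast this
    refine Nat.succ_le_of_lt (hk.trans_lt ?_)
    refine (upcrossingsBefore_lt_of_exists_upcrossing hab le_rfl ?_
      (Nat.floor_mono (mul_le_mul_left huv.le _)) ?_).trans_le (upcrossingsBefore_mono hab hlt ω)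
    · rwa [gridProcess, hnu, min_eq_left huT]
    · rwa [gridProcess, hnv, min_eq_left hvT]

theorem IsRegularUpTo.exists_tendsto {X : ℝ≥0 → Ω → ℝ} {t T : ℝ≥0} {ω : Ω}
    (h : IsRegularUpTo X T ω) (hX : ∀ s, 0 ≤ X s ω) (hT : T ∈ dyadicTimes) (htT : t < T) :
    ∃ c, Tendsto (fun s => X s ω) (𝓝[dyadicTimes ∩ Ioi t] t) (𝓝 c) := by
  have hmem : ∀ r, t < r → ∀ᶠ s in 𝓝[dyadicTimes ∩ Ioi t] t, s ∈ dyadicTimes ∧ t < s ∧ s < r := by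
    intro r hr
    filter_upwards [self_mem_nhdsWithin, nhdsWithin_le_nhds (Iio_mem_nhds hr)] with s hs hsr
    exact ⟨hs.1, hs.2, hsr⟩
  refine tendsto_of_no_upcrossings (Rat.denseRange_cast (𝕜 := ℝ)) ?_ ?_ ?_
  · rintro _ ⟨a, rfl⟩ _ ⟨b, rfl⟩ hab ⟨hfa, hfb⟩
    have key := eventually_le_upcrossingsBefore (T := T) (X := X) hab
      (fun r hr => by
        obtain ⟨s, h1, h2, h3, h4⟩ := (hfa.and_eventually (hmem r hr)).exists
        exact ⟨s, h2, h3, h4, h1⟩)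
      (fun r hr => by
        obtain ⟨s, h1, h2, h3, h4⟩ := (hfb.and_eventually (hmem r hr)).exists
        exact ⟨s, h2, h3, h4, h1⟩)
    refine (h.2 a b (by exact_mod_cast hab)).ne (ENNReal.eq_top_of_forall_nnreal_le fun r => ?_)
    obtain ⟨k, hk⟩ := exists_nat_ge r
    refine le_liminf_of_le (by isBoundedDefault) ?_
    filter_upwards [key k T hT htT le_rfl] with n hn
    exact (ENNReal.coe_le_coe.2 hk).trans (by exact_mod_cast hn)
  · obtain ⟨K, hK⟩ := h.1
    exact ⟨K, eventually_map.2 ((hmem T htT).mono fun s hs => hK s hs.1 hs.2.2.le)⟩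
  · exact ⟨0, eventually_map.2 (Eventually.of_forall hX)⟩

/-- The path of `X` is regular on some interval reaching strictly beyond `t`. -/
def IsRegularAfter (X : ℝ≥0 → Ω → ℝ) (t : ℝ≥0) (ω : Ω) : Prop :=
  ∃ T ∈ dyadicTimes, t < T ∧ ∀ S ∈ dyadicTimes, S ≤ T → IsRegularUpTo X S ω

open Classical in
/-- The value of `X` just after `t`, set to `0` from the first irregularity of the path on. -/
noncomputable def rightApprox (X : ℝ≥0 → Ω → ℝ) (n : ℕ) (t : ℝ≥0) (ω : Ω) : ℝ :=
  if IsRegularAfter X t ω then X (dyadicAbove t n) ω else 0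

/-- The right limits of `X` along dyadic times, set to `0` from the first irregularity on. -/
noncomputable def rightReg (X : ℝ≥0 → Ω → ℝ) (t : ℝ≥0) (ω : Ω) : ℝ :=
  limUnder atTop fun n => rightApprox X n t ω

variable {X : ℝ≥0 → Ω → ℝ}

theorem exists_tendsto_rightApprox (hX : ∀ t ω, 0 ≤ X t ω) (t : ℝ≥0) (ω : Ω) :
    ∃ c, Tendsto (fun n => rightApprox X n t ω) atTop (𝓝 c) ∧
      (IsRegularAfter X t ω → Tendsto (fun s => X s ω) (𝓝[dyadicTimes ∩ Ioi t] t) (𝓝 c)) := by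
  by_cases h : IsRegularAfter X t ω
  · obtain ⟨T, hT, htT, hreg⟩ := id h
    obtain ⟨c, hc⟩ := (hreg T hT le_rfl).exists_tendsto (fun s => hX s ω) hT htT
    refine ⟨c, ?_, fun _ => hc⟩
    simp only [rightApprox, h, if_true]
    exact hc.comp (tendsto_dyadicAbove t)
  · exact ⟨0, by simp [rightApprox, h], fun h' => absurd h' h⟩

theorem tendsto_rightApprox (hX : ∀ t ω, 0 ≤ X t ω) (t : ℝ≥0) (ω : Ω) :
    Tendsto (fun n => rightApprox X n t ω) atTop (𝓝 (rightReg X t ω)) := by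
  obtain ⟨c, hc, -⟩ := exists_tendsto_rightApprox hX t ω
  exact tendsto_nhds_limUnder ⟨c, hc⟩

theorem IsRegularAfter.tendsto_rightReg (hX : ∀ t ω, 0 ≤ X t ω) {t : ℝ≥0} {ω : Ω}
    (h : IsRegularAfter X t ω) :
    Tendsto (fun s => X s ω) (𝓝[dyadicTimes ∩ Ioi t] t) (𝓝 (rightReg X t ω)) := by
  obtain ⟨c, hc, hc'⟩ := exists_tendsto_rightApprox hX t ω
  rw [tendsto_nhds_unique (tendsto_rightApprox hX t ω) hc]
  exact hc' h

theorem rightApprox_nonneg (hX : ∀ t ω, 0 ≤ X t ω) (n : ℕ) (t : ℝ≥0) (ω : Ω) :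
    0 ≤ rightApprox X n t ω := by
  unfold rightApprox
  split_ifs
  exacts [hX _ _, le_rfl]

theorem rightReg_comp (X : ℝ≥0 → Ω' → ℝ) (φ : Ω → Ω') (t : ℝ≥0) (ω : Ω) :
    rightReg (fun t ω => X t (φ ω)) t ω = rightReg X t (φ ω) := by
  have h : IsRegularAfter (fun t ω => X t (φ ω)) t ω ↔ IsRegularAfter X t (φ ω) := by
    simp only [IsRegularAfter, isRegularUpTo_comp X φ]
  have happrox (n : ℕ) : rightApprox (fun t ω => X t (φ ω)) n t ω = rightApprox X n t (φ ω) := by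
    classical exact if_congr h rfl rfl
  simp only [rightReg, happrox]

theorem rightReg_nonneg (hX : ∀ t ω, 0 ≤ X t ω) (t : ℝ≥0) (ω : Ω) : 0 ≤ rightReg X t ω :=
  ge_of_tendsto' (tendsto_rightApprox hX t ω) fun n => rightApprox_nonneg hX n t ω

theorem continuousWithinAt_rightReg (hX : ∀ t ω, 0 ≤ X t ω) (t : ℝ≥0) (ω : Ω) :
    ContinuousWithinAt (fun s => rightReg X s ω) (Ici t) t := by
  by_cases h : IsRegularAfter X t ω
  · rw [← continuousWithinAt_Ioi_iff_Ici]
    refine (closed_nhds_basis (rightReg X t ω)).tendsto_right_iff.2 fun V ⟨hV, hVc⟩ => ?_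
    have hlim := h.tendsto_rightReg hX
    obtain ⟨T, hT, htT, hreg⟩ := h
    have hVev := hlim hV
    rw [mem_map, mem_nhdsWithin_iff_exists_mem_nhds_inter] at hVev
    obtain ⟨U, hU, hUV⟩ := hVev
    obtain ⟨r, htr, hr⟩ := (mem_nhdsGE_iff_exists_Ico_subset' htT).1 (mem_nhdsWithin_of_mem_nhds hU)
    filter_upwards [Ioo_mem_nhdsGT (lt_min htr htT)] with u hu
    have hu' := lt_min_iff.1 hu.2
    have hreg' : IsRegularAfter X u ω := ⟨T, hT, hu'.2, hreg⟩
    refine hVc.mem_of_tendsto ((hreg'.tendsto_rightReg hX).comp (tendsto_dyadicAbove u)) ?_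
    filter_upwards [eventually_dyadicAbove_lt hu'.1] with n hn
    have := hu.1.trans (lt_dyadicAbove u n)
    exact hUV ⟨hr ⟨this.le, hn⟩, dyadicAbove_mem u n, this⟩
  · have hzero : ∀ s ∈ Ici t, rightReg X s ω = 0 := by
      intro s hs
      have hs' : ¬ IsRegularAfter X s ω := fun ⟨T, hT, hsT, hreg⟩ =>
        h ⟨T, hT, lt_of_le_of_lt hs hsT, hreg⟩
      refine tendsto_nhds_unique (tendsto_rightApprox hX s ω) ?_
      simp [rightApprox, hs']
    exact continuousWithinAt_const.congr hzero (hzero t self_mem_Ici)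

section Measurability

variable {m : MeasurableSpace Ω}

theorem measurableSet_isRegularUpTo {T : ℝ≥0} (hT : T ∈ dyadicTimes)
    (hX : ∀ d ∈ dyadicTimes, d ≤ T → Measurable (X d)) :
    MeasurableSet {ω | IsRegularUpTo X T ω} := by
  have hgrid (n : ℕ) : StronglyAdapted (⟨fun _ => m, monotone_const, fun _ => le_rfl⟩ :
      Filtration ℕ m) (gridProcess X T n) := fun k =>
    (hX _ (min_mem_dyadicTimes (div_two_pow_mem_dyadicTimes k n) hT)
      (min_le_right _ _)).stronglyMeasurable
  have h : {ω | IsRegularUpTo X T ω} =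
      (⋃ K : ℕ, ⋂ d ∈ dyadicTimes ∩ Iic T, {ω | X d ω ≤ K}) ∩
        ⋂ (a : ℚ) (b : ℚ) (_ : a < b), {ω | liminf (fun n =>
          (upcrossingsBefore (a : ℝ) b (gridProcess X T n) ⌊T * 2 ^ n⌋₊ ω : ℝ≥0∞)) atTop < ∞} := by
    ext ω
    simp [IsRegularUpTo]
  rw [h]
  refine .inter (.iUnion fun K => .biInter (countable_dyadicTimes.mono inter_subset_left)
    fun d hd => measurableSet_le (hX d hd.1 hd.2) measurable_const) ?_
  refine .iInter fun a => .iInter fun b => .iInter fun hab =>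
    measurableSet_lt (.liminf fun n => ?_) measurable_const
  exact measurable_from_top.comp ((hgrid n).measurable_upcrossingsBefore (by exact_mod_cast hab))

theorem measurableSet_isRegularAfter {t u : ℝ≥0} (htu : t < u)
    (hX : ∀ d ∈ dyadicTimes, d < u → Measurable (X d)) :
    MeasurableSet {ω | IsRegularAfter X t ω} := by
  have h : {ω | IsRegularAfter X t ω} = ⋃ T ∈ dyadicTimes ∩ Ioo t u,
      ⋂ S ∈ dyadicTimes ∩ Iic T, {ω | IsRegularUpTo X S ω} := by
    ext ω
    simp only [IsRegularAfter, mem_ofPred_eq, mem_iUnion, mem_iInter, mem_inter_iff, mem_Ioo,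
      mem_Iic, exists_prop, and_imp]
    constructor
    · rintro ⟨T, hT, htT, hreg⟩
      obtain ⟨T', hT', htT', hT'u⟩ := exists_dyadicTimes_between (lt_min htu htT)
      have := lt_min_iff.1 hT'u
      exact ⟨T', ⟨hT', htT', this.1⟩, fun S hS hST => hreg S hS (hST.trans this.2.le)⟩
    · rintro ⟨T, ⟨hT, htT, -⟩, hreg⟩
      exact ⟨T, hT, htT, hreg⟩
  rw [h]
  refine .biUnion (countable_dyadicTimes.mono inter_subset_left) fun T hT =>
    .biInter (countable_dyadicTimes.mono inter_subset_left) fun S hS =>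
      measurableSet_isRegularUpTo hS.1 fun d hd hdS =>
        hX d hd ((hdS.trans hS.2).trans_lt hT.2.2)

theorem measurable_rightReg {t u : ℝ≥0} (htu : t < u) (hX0 : ∀ t ω, 0 ≤ X t ω)
    (hX : ∀ d ∈ dyadicTimes, d < u → Measurable (X d)) :
    Measurable (rightReg X t) := by
  obtain ⟨n₀, hn₀⟩ := eventually_atTop.1 (eventually_dyadicAbove_lt htu)
  refine measurable_of_tendsto_metrizable (f := fun n => rightApprox X (n + n₀) t) (fun n => ?_)
    (tendsto_pi_nhds.2 fun ω => (tendsto_add_atTop_iff_nat n₀).2 (tendsto_rightApprox hX0 t ω))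
  exact Measurable.ite (measurableSet_isRegularAfter htu hX)
    (hX _ (dyadicAbove_mem _ _) (hn₀ _ (Nat.le_add_left _ _))) measurable_const

theorem measurable_rightReg_prod (hX0 : ∀ t ω, 0 ≤ X t ω)
    (hX : ∀ d ∈ dyadicTimes, Measurable (X d)) :
    Measurable fun p : Ω × ℝ≥0 => rightReg X p.2 p.1 := by
  refine measurable_of_tendsto_metrizable (f := fun n (p : Ω × ℝ≥0) => rightApprox X n p.2 p.1)
    (fun n => ?_) (tendsto_pi_nhds.2 fun p => tendsto_rightApprox hX0 p.2 p.1)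
  refine Measurable.ite ?_ ?_ measurable_const
  · have h : {p : Ω × ℝ≥0 | IsRegularAfter X p.2 p.1} = ⋃ T ∈ dyadicTimes,
        (⋂ S ∈ dyadicTimes ∩ Iic T, {ω | IsRegularUpTo X S ω}) ×ˢ Iio T := by
      ext p
      simp only [IsRegularAfter, mem_ofPred_eq, mem_iUnion, mem_prod, mem_iInter, mem_inter_iff,
        mem_Iic, mem_Iio, exists_prop, and_imp]
      exact exists_congr fun T => and_congr_right fun _ => and_comm
    rw [h]
    exact .biUnion countable_dyadicTimes fun T _ => MeasurableSet.prod
      (.biInter (countable_dyadicTimes.mono inter_subset_left) fun S hS =>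
        measurableSet_isRegularUpTo hS.1 fun d hd _ => hX d hd) measurableSet_Iio
  · have h : Measurable fun p : Ω × ℕ => X (((p.2 + 1 : ℕ) : ℝ≥0) / 2 ^ n) p.1 :=
      measurable_from_prod_countable_left fun k => hX _ (div_two_pow_mem_dyadicTimes (k + 1) n)
    exact h.comp (f := fun p : Ω × ℝ≥0 => (p.1, ⌊p.2 * 2 ^ n⌋₊))
      (measurable_fst.prodMk ((measurable_floor_mul_two_pow n).comp measurable_snd))

end Measurability

end Regularization

section DyadicMartingale

variable {Ω : Type*} {mΩ : MeasurableSpace Ω}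

/-- A nonnegative process which is a martingale along the dyadic times. -/
structure IsDyadicMartingale (Y : ℝ≥0 → Ω → ℝ) (F : Filtration ℝ≥0 mΩ) (P : Measure Ω) : Prop where
  nonneg : ∀ t ω, 0 ≤ Y t ω
  measurable : ∀ d ∈ dyadicTimes, Measurable[F d] (Y d)
  integrable : ∀ d ∈ dyadicTimes, Integrable (Y d) P
  condExp : ∀ s ∈ dyadicTimes, ∀ t ∈ dyadicTimes, s ≤ t → P[Y t | F s] =ᵐ[P] Y s

/-- The filtration `F` stopped at `T` and sampled along the grid of mesh `2⁻ⁿ`. -/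
noncomputable def gridFiltration (F : Filtration ℝ≥0 mΩ) (T : ℝ≥0) (n : ℕ) : Filtration ℕ mΩ where
  seq k := F (min ((k : ℝ≥0) / 2 ^ n) T)
  mono' _ _ h := F.mono (by gcongr)
  le' _ := F.le _

namespace IsDyadicMartingale

variable {P : Measure Ω} {F : Filtration ℝ≥0 mΩ} {Y : ℝ≥0 → Ω → ℝ} {T : ℝ≥0}

theorem martingale_gridProcess (hY : IsDyadicMartingale Y F P) (hT : T ∈ dyadicTimes) (n : ℕ) :
    Martingale (gridProcess Y T n) (gridFiltration F T n) P := by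
  have hmem (k : ℕ) := min_mem_dyadicTimes (div_two_pow_mem_dyadicTimes k n) hT
  refine ⟨fun k => (hY.measurable _ (hmem k)).stronglyMeasurable, fun i j hij => ?_⟩
  exact hY.condExp _ (hmem i) _ (hmem j) (by gcongr)

variable [IsFiniteMeasure P]

theorem integral_eq (hY : IsDyadicMartingale Y F P) {s t : ℝ≥0} (hs : s ∈ dyadicTimes)
    (ht : t ∈ dyadicTimes) (hst : s ≤ t) : ∫ ω, Y s ω ∂P = ∫ ω, Y t ω ∂P := by
  rw [← integral_condExp (F.le s) (f := Y t), integral_congr_ae (hY.condExp s hs t ht hst)]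

theorem lintegral_upcrossingsBefore_le (hY : IsDyadicMartingale Y F P) (hT : T ∈ dyadicTimes)
    {a b : ℝ} (hab : a < b) (n N : ℕ) :
    ∫⁻ ω, (upcrossingsBefore a b (gridProcess Y T n) N ω : ℝ≥0∞) ∂P ≤
      ENNReal.ofReal ((∫ ω, Y T ω ∂P + ∫ _, |a| ∂P) / (b - a)) := by
  have hmart := hY.martingale_gridProcess hT n
  have hmem := min_mem_dyadicTimes (div_two_pow_mem_dyadicTimes N n) hT
  have hint := hmart.stronglyAdapted.integrable_upcrossingsBefore (μ := P) (N := N) hab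
  have h1 := hmart.submartingale.mul_integral_upcrossingsBefore_le_integral_pos_part a b N
  have h2 : ∫ ω, (gridProcess Y T n N ω - a)⁺ ∂P ≤ ∫ ω, Y T ω ∂P + ∫ _, |a| ∂P := by
    rw [← hY.integral_eq hmem hT (min_le_right _ _),
      ← integral_add (hY.integrable _ hmem) (integrable_const _)]
    refine integral_mono_of_nonneg (ae_of_all _ fun ω => posPart_nonneg _)
      ((hY.integrable _ hmem).add (integrable_const _)) (ae_of_all _ fun ω => ?_)
    have := hY.nonneg (min ((N : ℝ≥0) / 2 ^ n) T) ω
    exact sup_le (by simp only [gridProcess]; linarith [neg_abs_le a])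
      (add_nonneg this (abs_nonneg a))
  calc ∫⁻ ω, (upcrossingsBefore a b (gridProcess Y T n) N ω : ℝ≥0∞) ∂P
      = ENNReal.ofReal (∫ ω, (upcrossingsBefore a b (gridProcess Y T n) N ω : ℝ) ∂P) := by
        rw [ofReal_integral_eq_lintegral_ofReal hint (ae_of_all _ fun ω => Nat.cast_nonneg _)]
        simp
    _ ≤ _ := ENNReal.ofReal_le_ofReal <| by
        rw [le_div_iff₀ (sub_pos.2 hab), mul_comm]
        exact h1.trans h2

theorem ae_liminf_upcrossingsBefore_lt_top (hY : IsDyadicMartingale Y F P) (hT : T ∈ dyadicTimes)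
    {a b : ℝ} (hab : a < b) (N : ℕ → ℕ) :
    ∀ᵐ ω ∂P, liminf (fun n => (upcrossingsBefore a b (gridProcess Y T n) (N n) ω : ℝ≥0∞)) atTop
      < ∞ := by
  have hmeas (n : ℕ) : Measurable fun ω =>
      (upcrossingsBefore a b (gridProcess Y T n) (N n) ω : ℝ≥0∞) :=
    measurable_from_top.comp
      ((hY.martingale_gridProcess hT n).stronglyAdapted.measurable_upcrossingsBefore hab)
  refine ae_lt_top (.liminf hmeas) (ne_of_lt ?_)
  calc _ ≤ _ := lintegral_liminf_le hmeas
    _ ≤ _ := liminf_le_liminf (Eventually.of_forall fun n =>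
        hY.lintegral_upcrossingsBefore_le hT hab n (N n))
    _ = _ := liminf_const _
    _ < ∞ := ENNReal.ofReal_lt_top

theorem mul_measure_exists_le (hY : IsDyadicMartingale Y F P) (hT : T ∈ dyadicTimes) (K : ℝ≥0) :
    K * P {ω | ∃ d ∈ dyadicTimes, d ≤ T ∧ (K : ℝ) ≤ Y d ω} ≤ ENNReal.ofReal (∫ ω, Y T ω ∂P) := by
  set A : ℕ → Set Ω := fun n => {ω | ∃ k ≤ ⌊T * 2 ^ n⌋₊, (K : ℝ) ≤ gridProcess Y T n k ω} with hA
  have hmono : Monotone A := by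
    refine monotone_nat_of_le_succ fun n ω ⟨k, hk, hkω⟩ => ⟨k * 2, ?_, ?_⟩
    · rw [Nat.le_floor_iff (zero_le)] at hk ⊢
      push_cast
      rw [pow_succ, ← mul_assoc]
      gcongr
    · have : ((k * 2 : ℕ) : ℝ≥0) / 2 ^ (n + 1) = k / 2 ^ n := by
        push_cast
        rw [pow_succ, mul_div_mul_right _ _ two_ne_zero]
      simpa only [gridProcess, this] using hkω
  have hsub : {ω | ∃ d ∈ dyadicTimes, d ≤ T ∧ (K : ℝ) ≤ Y d ω} ⊆ ⋃ n, A n := by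
    rintro ω ⟨d, ⟨⟨k, n⟩, rfl⟩, hd, hK⟩
    refine mem_iUnion.2 ⟨n, k, ?_, ?_⟩
    · rw [Nat.le_floor_iff (zero_le)]
      exact (div_le_iff₀ (by positivity)).1 hd
    · simpa only [gridProcess, min_eq_left hd] using hK
  have hbound (n : ℕ) : K * P (A n) ≤ ENNReal.ofReal (∫ ω, Y T ω ∂P) := by
    have hmart := hY.martingale_gridProcess hT n
    have hmem := min_mem_dyadicTimes (div_two_pow_mem_dyadicTimes ⌊T * 2 ^ n⌋₊ n) hT
    have h := maximal_ineq hmart.submartingale (fun k ω => hY.nonneg _ ω) (ε := K) ⌊T * 2 ^ n⌋₊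
    have hset : {ω | (K : ℝ) ≤ (Finset.range (⌊T * 2 ^ n⌋₊ + 1)).sup' Finset.nonempty_range_add_one
        fun k => gridProcess Y T n k ω} = A n := by
      ext ω
      simp [hA, Finset.le_sup'_iff]
    rw [hset] at h
    refine h.trans (ENNReal.ofReal_le_ofReal ?_)
    rw [← hY.integral_eq hmem hT (min_le_right _ _)]
    exact setIntegral_le_integral (hY.integrable _ hmem) (ae_of_all _ fun ω => hY.nonneg _ ω)
  calc K * P {ω | ∃ d ∈ dyadicTimes, d ≤ T ∧ (K : ℝ) ≤ Y d ω}
      ≤ K * ⨆ n, P (A n) := by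
        rw [← hmono.measure_iUnion]
        gcongr
    _ ≤ _ := by
        rw [ENNReal.mul_iSup]
        exact iSup_le hbound

theorem ae_exists_forall_le (hY : IsDyadicMartingale Y F P) (hT : T ∈ dyadicTimes) :
    ∀ᵐ ω ∂P, ∃ K : ℕ, ∀ d ∈ dyadicTimes, d ≤ T → Y d ω ≤ K := by
  set C := ENNReal.ofReal (∫ ω, Y T ω ∂P)
  have hlim : Tendsto (fun n : ℕ => C / (n : ℝ≥0∞)) atTop (𝓝 0) := by
    simpa [C] using ENNReal.Tendsto.div (tendsto_const_nhds (x := C) (f := atTop))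
      (Or.inr (by simp)) ENNReal.tendsto_nat_nhds_top (Or.inr ENNReal.ofReal_ne_top)
  refine measure_mono_null (t := {ω | ∀ n : ℕ, ∃ d ∈ dyadicTimes, d ≤ T ∧ (n : ℝ) ≤ Y d ω})
    (fun ω hω n => ?_) (le_antisymm (ge_of_tendsto hlim ?_) zero_le)
  · simp only [mem_compl_iff, mem_ofPred_eq, not_exists, not_forall, not_le] at hω
    obtain ⟨d, hd, hdT, h⟩ := hω n
    exact ⟨d, hd, hdT, h.le⟩
  · filter_upwards [eventually_gt_atTop 0] with n hn
    rw [ENNReal.le_div_iff_mul_le (Or.inl (by simp [hn.ne'])) (Or.inl (by simp)), mul_comm]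
    have h := hY.mul_measure_exists_le hT n
    refine le_trans ?_ h
    push_cast
    gcongr
    exact fun hω => by simpa using hω n

theorem ae_isRegularAfter (hY : IsDyadicMartingale Y F P) :
    ∀ᵐ ω ∂P, ∀ t, IsRegularAfter Y t ω := by
  have h : ∀ᵐ ω ∂P, ∀ T ∈ dyadicTimes, IsRegularUpTo Y T ω := by
    refine (ae_ball_iff countable_dyadicTimes).2 fun T hT => (hY.ae_exists_forall_le hT).and ?_
    refine ae_all_iff.2 fun a => ae_all_iff.2 fun b => ?_
    by_cases hab : a < b
    · filter_upwards [hY.ae_liminf_upcrossingsBefore_lt_top hT (Rat.cast_lt (K := ℝ).2 hab) _]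
        with ω hω _ using hω
    · exact ae_of_all _ fun ω h => absurd h hab
  filter_upwards [h] with ω hω t
  obtain ⟨T, hT, htT, -⟩ := exists_dyadicTimes_between (lt_add_one t)
  exact ⟨T, hT, htT, fun S hS _ => hω S hS⟩

theorem integrable_rightReg_and_setIntegral_eq (hY : IsDyadicMartingale Y F P)
    (hT : T ∈ dyadicTimes) {t : ℝ≥0} (htT : t < T) :
    Integrable (rightReg Y t) P ∧
      ∀ A, MeasurableSet[F t] A → ∫ ω in A, rightReg Y t ω ∂P = ∫ ω in A, Y T ω ∂P := by
  set d : ℕ → ℝ≥0 := fun n => min (dyadicAbove t n) T with hd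
  have hdmem (n : ℕ) : d n ∈ dyadicTimes := min_mem_dyadicTimes (dyadicAbove_mem t n) hT
  have htd (n : ℕ) : t < d n := lt_min (lt_dyadicAbove t n) htT
  have hdlim : Tendsto d atTop (𝓝[dyadicTimes ∩ Ioi t] t) := by
    refine tendsto_nhdsWithin_iff.2 ⟨?_, Eventually.of_forall fun n => ⟨hdmem n, htd n⟩⟩
    have := (tendsto_nhds_of_tendsto_nhdsWithin (tendsto_dyadicAbove t)).min
      (tendsto_const_nhds (x := T))
    rwa [min_eq_left htT.le] at this
  have hlim : ∀ᵐ ω ∂P, Tendsto (fun n => Y (d n) ω) atTop (𝓝 (rightReg Y t ω)) := by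
    filter_upwards [hY.ae_isRegularAfter] with ω hω
    exact ((hω t).tendsto_rightReg hY.nonneg).comp hdlim
  have hui : UniformIntegrable (fun n => Y (d n)) 1 P :=
    ((hY.integrable T hT).uniformIntegrable_condExp fun n => F.le (d n)).ae_eq
      fun n => hY.condExp _ (hdmem n) _ hT (min_le_right _ _)
  have hint := hui.integrable_of_ae_tendsto hlim
  refine ⟨hint, fun A hA => ?_⟩
  have hL1 := tendsto_Lp_finite_of_tendsto_ae le_rfl ENNReal.one_ne_top
    (fun n => (hY.integrable _ (hdmem n)).aestronglyMeasurable) (memLp_one_iff_integrable.2 hint)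
    hui.unifIntegrable hlim
  have h := tendsto_setIntegral_of_L1' _ hint.aestronglyMeasurable
    (Eventually.of_forall fun n => hY.integrable _ (hdmem n)) hL1 A
  refine tendsto_nhds_unique h (tendsto_const_nhds.congr fun n => ?_)
  rw [← setIntegral_condExp (F.le (d n)) (hY.integrable T hT) (F.mono (htd n).le A hA)]
  exact setIntegral_congr_ae (F.le t A hA)
    ((hY.condExp _ (hdmem n) _ hT (min_le_right _ _)).mono fun ω h _ => h)

theorem martingale_rightReg (hY : IsDyadicMartingale Y F P)
    (hadapted : Adapted F (rightReg Y)) : Martingale (rightReg Y) F P := by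
  refine ⟨fun t => (hadapted t).stronglyMeasurable, fun s t hst => ?_⟩
  obtain ⟨T, hT, htT, -⟩ := exists_dyadicTimes_between (lt_add_one t)
  obtain ⟨hs_int, hs⟩ := hY.integrable_rightReg_and_setIntegral_eq hT (hst.trans_lt htT)
  obtain ⟨ht_int, ht⟩ := hY.integrable_rightReg_and_setIntegral_eq hT htT
  refine (ae_eq_condExp_of_forall_setIntegral_eq (F.le s) ht_int
    (fun A _ _ => hs_int.integrableOn) (fun A hA _ => ?_)
    (hadapted s).stronglyMeasurable.aestronglyMeasurable).symm
  rw [hs A hA, ht A (F.mono hst A hA)]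

end IsDyadicMartingale

end DyadicMartingale

section Family

variable {Ω : Type*} {mΩ : MeasurableSpace Ω} {P : Measure Ω}

theorem MeasureTheory.Filtration.measurable_of_forall_gt {β : Type*} [MeasurableSpace β]
    {F : Filtration ℝ≥0 mΩ} {t : ℝ≥0} (ht : F t = ⨅ (ε : ℝ≥0) (_ : 0 < ε), F (t + ε))
    {h : Ω → β} (hh : ∀ u, t < u → Measurable[F u] h) : Measurable[F t] h := by
  intro s hs
  rw [ht]
  simp only [MeasurableSpace.measurableSet_iInf]
  exact fun ε hε => hh _ (lt_add_of_pos_right t hε) hs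

theorem ae_forall_measure_eq_of_forall_ae_eq {E : Type*} [mE : MeasurableSpace E]
    [MeasurableSpace.CountablyGenerated E] {ν ν' : Ω → Measure E} (hν : ∀ ω, IsFiniteMeasure (ν ω))
    (h : ∀ B, MeasurableSet B → ∀ᵐ ω ∂P, ν ω B = ν' ω B) : ∀ᵐ ω ∂P, ν ω = ν' ω := by
  set 𝒞 := generateSetAlgebra (MeasurableSpace.countableGeneratingSet E)
  have h𝒞 : IsSetAlgebra 𝒞 := isSetAlgebra_generateSetAlgebra
  have hgen : mE = MeasurableSpace.generateFrom 𝒞 := by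
    rw [generateFrom_generateSetAlgebra_eq, MeasurableSpace.generateFrom_countableGeneratingSet]
  have hcount : 𝒞.Countable :=
    countable_generateSetAlgebra MeasurableSpace.countable_countableGeneratingSet
  have hall : ∀ᵐ ω ∂P, ∀ B ∈ 𝒞, ν ω B = ν' ω B := (ae_ball_iff hcount).2 fun B hB =>
    h B (hgen ▸ MeasurableSpace.measurableSet_generateFrom hB)
  filter_upwards [hall] with ω hω
  exact ext_of_generate_finite 𝒞 hgen (fun s hs t ht _ => h𝒞.inter_mem hs ht) hω
    (hω _ h𝒞.univ_mem)

variable [IsFiniteMeasure P]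

theorem ae_eq_of_forall_setLIntegral_eq_of_le {m : MeasurableSpace Ω} (hm : m ≤ mΩ)
    {g h : Ω → ℝ≥0∞} (hg : Measurable[m] g) (hh : Measurable[m] h)
    (hgh : ∀ A, MeasurableSet[m] A → ∫⁻ ω in A, g ω ∂P = ∫⁻ ω in A, h ω ∂P) : g =ᵐ[P] h := by
  refine ae_eq_of_ae_eq_trim (hm := hm)
    (ae_eq_of_forall_setLIntegral_eq_of_sigmaFinite hg hh fun A hA _ => ?_)
  rw [setLIntegral_trim hm hg hA, setLIntegral_trim hm hh hA, hgh A hA]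

variable {E : Type*} [mE : MeasurableSpace E] {μ : Measure E} [IsFiniteMeasure μ]
  {F : Filtration ℝ≥0 mΩ} {f : ℝ≥0 → E × Ω → ℝ≥0∞}

theorem ae_isDyadicMartingale (hf : ∀ d, Measurable[mE.prod (F d)] (f d))
    (hfin : ∀ d ∈ dyadicTimes, ∫⁻ x, ∫⁻ ω, f d (x, ω) ∂P ∂μ ≠ ∞)
    (hcons : ∀ s ∈ dyadicTimes, ∀ t ∈ dyadicTimes, s ≤ t → ∀ B, MeasurableSet B →
      ∀ A, MeasurableSet[F s] A →
        ∫⁻ x in B, ∫⁻ ω in A, f s (x, ω) ∂P ∂μ = ∫⁻ x in B, ∫⁻ ω in A, f t (x, ω) ∂P ∂μ) :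
    ∀ᵐ x ∂μ, IsDyadicMartingale (fun t ω => (f t (x, ω)).toReal) F P ∧
      ∀ d ∈ dyadicTimes, ∀ᵐ ω ∂P, f d (x, ω) < ∞ := by
  have hf' (d : ℝ≥0) : Measurable (f d) := (hf d).prod_mono_right (F.le d)
  have hsec (d : ℝ≥0) (x : E) : Measurable[F d] fun ω => f d (x, ω) :=
    Measurable.prod_section (hf d) x
  have hfin' : ∀ᵐ x ∂μ, ∀ d ∈ dyadicTimes, ∫⁻ ω, f d (x, ω) ∂P < ∞ :=
    (ae_ball_iff countable_dyadicTimes).2 fun d hd =>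
      ae_lt_top (hf' d).lintegral_prod_right' (hfin d hd)
  have hcons' : ∀ᵐ x ∂μ, ∀ s ∈ dyadicTimes, ∀ t ∈ dyadicTimes, s ≤ t → ∀ A, MeasurableSet[F s] A →
      ∫⁻ ω in A, f s (x, ω) ∂P = ∫⁻ ω in A, f t (x, ω) ∂P := by
    refine (ae_ball_iff countable_dyadicTimes).2 fun s hs =>
      (ae_ball_iff countable_dyadicTimes).2 fun t ht => ?_
    by_cases hst : s ≤ t
    swap
    · exact ae_of_all _ fun x h => absurd h hst
    have hπ : @MeasurePreserving Ω Ω mΩ (F s) id P (P.trim (F.le s)) :=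
      @MeasurePreserving.mk _ _ mΩ (F s) _ _ _ (measurable_id'' (F.le s)) (trim_eq_map (F.le s)).symm
    have h := ae_forall_setLIntegral_eq_of_setLIntegral_prod_eq hπ μ (hf' t) (hf s) (hfin t ht)
      fun B hB A hA => by
        rw [preimage_id, ← hcons s hs t ht hst B hB A hA]
        exact lintegral_congr fun x => setLIntegral_trim (F.le s) (hsec s x) hA
    filter_upwards [h] with x hx _ A hA
    rw [← setLIntegral_trim (F.le s) (hsec s x) hA, hx A hA, preimage_id]
  filter_upwards [hfin', hcons'] with x hx hcx
  have hlt (d : ℝ≥0) (hd : d ∈ dyadicTimes) : ∀ᵐ ω ∂P, f d (x, ω) < ∞ :=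
    ae_lt_top ((hf' d).prod_section x) (hx d hd).ne
  have hint (d : ℝ≥0) (hd : d ∈ dyadicTimes) : Integrable (fun ω => (f d (x, ω)).toReal) P :=
    integrable_toReal_of_lintegral_ne_top ((hf' d).prod_section x).aemeasurable (hx d hd).ne
  refine ⟨⟨fun _ _ => ENNReal.toReal_nonneg, fun d _ => (hsec d x).ennreal_toReal, hint,
    fun s hs t ht hst => ?_⟩, hlt⟩
  refine (ae_eq_condExp_of_forall_setIntegral_eq (F.le s) (hint t ht)
    (fun A _ _ => (hint s hs).integrableOn) (fun A hA _ => ?_)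
    (hsec s x).ennreal_toReal.stronglyMeasurable.aestronglyMeasurable).symm
  rw [integral_toReal ((hf' s).prod_section x).aemeasurable (ae_restrict_of_ae (hlt s hs)),
    integral_toReal ((hf' t).prod_section x).aemeasurable (ae_restrict_of_ae (hlt t ht)),
    hcx s hs t ht hst A hA]

theorem isDyadicMartingale_zero : IsDyadicMartingale (fun _ _ => 0) F P where
  nonneg _ _ := le_rfl
  measurable _ _ := measurable_const
  integrable _ _ := integrable_zero _ _ _
  condExp s _ _ _ _ := by
    rw [condExp_const (F.le s)]

theorem exists_forall_isDyadicMartingale (hf : ∀ d, Measurable[mE.prod (F d)] (f d))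
    (hfin : ∀ d ∈ dyadicTimes, ∫⁻ x, ∫⁻ ω, f d (x, ω) ∂P ∂μ ≠ ∞)
    (hcons : ∀ s ∈ dyadicTimes, ∀ t ∈ dyadicTimes, s ≤ t → ∀ B, MeasurableSet B →
      ∀ A, MeasurableSet[F s] A →
        ∫⁻ x in B, ∫⁻ ω in A, f s (x, ω) ∂P ∂μ = ∫⁻ x in B, ∫⁻ ω in A, f t (x, ω) ∂P ∂μ) :
    ∃ X : ℝ≥0 → E × Ω → ℝ, (∀ t p, 0 ≤ X t p) ∧ (∀ d, Measurable[mE.prod (F d)] (X d)) ∧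
      (∀ x, IsDyadicMartingale (fun t ω => X t (x, ω)) F P) ∧
      ∀ᵐ x ∂μ, ∀ d ∈ dyadicTimes, ∀ᵐ ω ∂P, ENNReal.ofReal (X d (x, ω)) = f d (x, ω) := by
  classical
  have hae := ae_isDyadicMartingale hf hfin hcons
  set N := toMeasurable μ {x | ¬ (IsDyadicMartingale (fun t ω => (f t (x, ω)).toReal) F P ∧
      ∀ d ∈ dyadicTimes, ∀ᵐ ω ∂P, f d (x, ω) < ∞)} with hN
  have hNnull : μ N = 0 := (measure_toMeasurable _).trans hae
  have hNmeas : MeasurableSet N := measurableSet_toMeasurable _ _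
  have hgood (x : E) (hx : x ∉ N) := not_not.1 fun h => hx (subset_toMeasurable μ _ h)
  refine ⟨fun t p => if p.1 ∈ N then 0 else (f t p).toReal, fun t p => ?_, fun d => ?_,
    fun x => ?_, ?_⟩
  · dsimp only
    split_ifs
    exacts [le_rfl, ENNReal.toReal_nonneg]
  · let _ : MeasurableSpace Ω := F d
    exact Measurable.ite (measurable_fst hNmeas) measurable_const (hf d).ennreal_toReal
  · by_cases hx : x ∈ N
    · simpa [hx] using isDyadicMartingale_zero
    · simpa [hx] using (hgood x hx).1
  · filter_upwards [measure_eq_zero_iff_ae_notMem.1 hNnull] with x hx d hd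
    filter_upwards [(hgood x hx).2 d hd] with ω hω
    simp [hx, hω.ne]

end Family

section RightReg

variable {Ω E : Type*} {mΩ : MeasurableSpace Ω} {mE : MeasurableSpace E} {P : Measure Ω}
  [IsFiniteMeasure P] {μ : Measure E} [IsFiniteMeasure μ]

theorem setLIntegral_setLIntegral_swap {g : E × Ω → ℝ≥0∞} (hg : Measurable g) (A : Set Ω)
    (B : Set E) :
    ∫⁻ ω in A, ∫⁻ x in B, g (x, ω) ∂μ ∂P = ∫⁻ x in B, ∫⁻ ω in A, g (x, ω) ∂P ∂μ :=
  lintegral_lintegral_swap (f := fun ω x => g (x, ω)) (hg.comp measurable_swap).aemeasurable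

theorem IsDyadicMartingale.setLIntegral_rightReg_eq {F : Filtration ℝ≥0 mΩ} {Y : ℝ≥0 → Ω → ℝ}
    (hY : IsDyadicMartingale Y F P) {t T : ℝ≥0} (hT : T ∈ dyadicTimes) (htT : t < T) {A : Set Ω}
    (hA : MeasurableSet[F t] A) :
    ∫⁻ ω in A, ENNReal.ofReal (rightReg Y t ω) ∂P = ∫⁻ ω in A, ENNReal.ofReal (Y T ω) ∂P := by
  obtain ⟨hint, h⟩ := hY.integrable_rightReg_and_setIntegral_eq hT htT
  rw [← ofReal_integral_eq_lintegral_ofReal hint.integrableOn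
      (ae_of_all _ fun ω => rightReg_nonneg hY.nonneg t ω),
    ← ofReal_integral_eq_lintegral_ofReal (hY.integrable T hT).integrableOn
      (ae_of_all _ fun ω => hY.nonneg T ω), h A hA]

end RightReg

end DensityFamily

/-- Under Jacod's density hypothesis there exists a density family for `L`:
a jointly measurable nonnegative function `q`, right-continuous in `t`, such that each
`(q x · t)` is an `F`-adapted martingale and `ν t ω = q · t ω • λ` for `P`-a.e. `ω`. -/
theorem jacod_exists_density_family
    {Ω : Type*} {mΩ : MeasurableSpace Ω} {P : Measure Ω} [IsProbabilityMeasure P]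
    {E : Type*} [MeasurableSpace E] [StandardBorelSpace E]
    (F : Filtration ℝ≥0 mΩ)
    (hF_rc : ∀ t : ℝ≥0, F t = ⨅ (ε : ℝ≥0) (_ : 0 < ε), F (t + ε))
    (L : Ω → E) (hL : Measurable L)
    (lam : Measure E) (hlam : P.map L = lam)
    (ν : ℝ≥0 → Ω → Measure E)
    (hν_prob : ∀ (t : ℝ≥0) (ω : Ω), IsProbabilityMeasure (ν t ω))
    (hν_meas : ∀ (t : ℝ≥0) (B : Set E), MeasurableSet B →
      Measurable[F t] fun ω => ν t ω B)
    (hν_cond : ∀ (t : ℝ≥0) (B : Set E), MeasurableSet B →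
      ∀ A : Set Ω, MeasurableSet[F t] A →
        ∫⁻ ω in A, ν t ω B ∂P = P (A ∩ L ⁻¹' B))
    (hJacod : ∀ t : ℝ≥0, ∀ᵐ ω ∂P, ν t ω ≪ lam) :
    ∃ q : E → Ω → ℝ≥0 → ℝ,
      Measurable (fun p : E × Ω × ℝ≥0 => q p.1 p.2.1 p.2.2) ∧
      (∀ x ω t, 0 ≤ q x ω t) ∧
      (∀ (x : E) (ω : Ω) (t : ℝ≥0),
        ContinuousWithinAt (fun s => q x ω s) (Set.Ici t) t) ∧
      (∀ x : E, Adapted F fun t ω => q x ω t) ∧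
      (∀ x : E, Martingale (fun t ω => q x ω t) F P) ∧
      (∀ t : ℝ≥0, ∀ᵐ ω ∂P, ∀ B : Set E, MeasurableSet B →
        ν t ω B = ∫⁻ x in B, ENNReal.ofReal (q x ω t) ∂lam) := by
  have : IsProbabilityMeasure lam := hlam ▸ Measure.isProbabilityMeasure_map hL.aemeasurable
  choose f hf hfν using fun t =>
    exists_measurable_withDensity_eq (mΩ := F t) lam (ν t) (hν_prob t) (hν_meas t)
  have hrect (t : ℝ≥0) (B : Set E) (hB : MeasurableSet B) (A : Set Ω) (hA : MeasurableSet[F t] A) :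
      ∫⁻ x in B, ∫⁻ ω in A, f t (x, ω) ∂P ∂lam = P (A ∩ L ⁻¹' B) := by
    rw [← setLIntegral_setLIntegral_swap ((hf t).prod_mono_right (F.le t)), ← hν_cond t B hB A hA]
    refine lintegral_congr_ae (ae_restrict_of_ae ?_)
    filter_upwards [hJacod t] with ω hω using hfν t ω hω B hB
  obtain ⟨X, hX0, hXm, hX, hXf⟩ := exists_forall_isDyadicMartingale (P := P) (μ := lam) hf
    (fun d _ => by
      have h := hrect d univ .univ univ .univ
      rw [setLIntegral_univ] at h
      simp only [setLIntegral_univ] at h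
      rw [h]
      exact measure_ne_top _ _)
    (fun s _ t _ hst B hB A hA => by rw [hrect s B hB A hA, hrect t B hB A (F.mono hst A hA)])
  have hq (x : E) (ω : Ω) (t : ℝ≥0) :
      rightReg (fun t ω => X t (x, ω)) t ω = rightReg X t (x, ω) :=
    rightReg_comp X (Prod.mk x) t ω
  have hXu {t u : ℝ≥0} (htu : t < u) :
      @Measurable _ _ (Prod.instMeasurableSpace (m₂ := F u)) _ (rightReg X t) :=
    measurable_rightReg htu hX0 fun d _ hdu =>
      (hXm d).prod_mono_right (F.mono hdu.le)
  have hXt (t : ℝ≥0) : Measurable (rightReg X t) := (hXu (lt_add_one t)).prod_mono_right (F.le _)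
  have hadapted (x : E) : Adapted F (rightReg fun t ω => X t (x, ω)) := fun t => by
    refine Filtration.measurable_of_forall_gt (hF_rc t) fun u htu => ?_
    rw [funext fun ω => hq x ω t]
    exact Measurable.prod_section (hXu htu) x
  refine ⟨fun x ω t => rightReg (fun t ω => X t (x, ω)) t ω, ?_,
    fun x ω t => rightReg_nonneg (hX x).nonneg t ω,
    fun x ω t => continuousWithinAt_rightReg (hX x).nonneg t ω,
    hadapted, fun x => (hX x).martingale_rightReg (hadapted x), fun t => ?_⟩
  · simp only [hq]
    exact (measurable_rightReg_prod hX0 fun d _ => (hXm d).prod_mono_right (F.le d)).comp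
      (f := fun p : E × Ω × ℝ≥0 => ((p.1, p.2.1), p.2.2)) (by fun_prop)
  simp only [hq]
  obtain ⟨T, hT, htT, -⟩ := exists_dyadicTimes_between (lt_add_one t)
  have h := ae_forall_measure_eq_of_forall_ae_eq (P := P) (ν := ν t)
    (ν' := fun ω => lam.withDensity fun x => ENNReal.ofReal (rightReg X t (x, ω)))
    (fun ω => have := hν_prob t ω; inferInstance) fun B hB => ?_
  · filter_upwards [h] with ω hω B hB
    rw [hω, withDensity_apply _ hB]
  simp only [withDensity_apply _ hB]
  refine ae_eq_of_forall_setLIntegral_eq_of_le (F.le t) (hν_meas t B hB)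
    (Filtration.measurable_of_forall_gt (hF_rc t) fun u htu => ?_) fun A hA => ?_
  · let _ : MeasurableSpace Ω := F u
    exact (hXu htu).ennreal_ofReal.lintegral_prod_left'
  rw [hν_cond t B hB A hA, setLIntegral_setLIntegral_swap (hXt t).ennreal_ofReal,
    ← hrect T B hB A (F.mono htT.le A hA)]
  refine lintegral_congr_ae (ae_restrict_of_ae ?_)
  filter_upwards [hXf] with x hx
  simp only [← hq]
  rw [(hX x).setLIntegral_rightReg_eq hT htT hA]
  refine lintegral_congr_ae (ae_restrict_of_ae ?_)
  filter_upwards [hx T hT] with ω hω using hω.symm
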